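/- For every N ≥ 1, the family {φ_m}_{m ∈ ℕᴺ} is an orthogonal basis of L²(ℝᴺ; ℂ): each φ_m is a nonzero element of L², ⟪φ_m, φ_n⟫_{L²} = 0 whenever m ≠ n, and the closure of the linear span of {φ_m : m ∈ ℕᴺ} is all of L²(ℝᴺ; ℂ). -/

import Mathlib

/-!
The family `{φ_m}_{m ∈ ℕᴺ}` is an orthogonal basis of `L²(ℝᴺ; ℂ)`.
-/

open MeasureTheory
open scoped InnerProductSpace

noncomputable section

/-- The partial derivative `∂f/∂xⱼ` of a function `f : ℝᴺ → ℂ`. -/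
def pd {N : ℕ} (j : Fin N) (f : (Fin N → ℝ) → ℂ) : (Fin N → ℝ) → ℂ :=
  fun x => fderiv ℝ f x (Pi.single j 1)

/-- The operator `Aⱼ⁻ f = ∂f/∂xⱼ − 2π xⱼ f`. -/
def Aminus {N : ℕ} (j : Fin N) (f : (Fin N → ℝ) → ℂ) : (Fin N → ℝ) → ℂ :=
  fun x => pd j f x - ((2 * Real.pi * x j : ℝ) : ℂ) * f x

/-- The Gaussian `φ₀(x) = exp(−π Σⱼ xⱼ²)`, viewed as a `ℂ`-valued function. -/
def gaussian (N : ℕ) : (Fin N → ℝ) → ℂ :=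
  fun x => ((Real.exp (-Real.pi * ∑ j, x j ^ 2) : ℝ) : ℂ)

/-- `(A₁⁻)^{m₁} ⋯ (A_N⁻)^{m_N} f`. -/
def iterAminus {N : ℕ} (m : Fin N → ℕ) (f : (Fin N → ℝ) → ℂ) : (Fin N → ℝ) → ℂ :=
  (List.finRange N).foldl (fun g j => (fun h => Aminus j h)^[m j] g) f

/-- `φ_m = (m₁!⋯m_N!)^{−1/2} (A₁⁻)^{m₁} ⋯ (A_N⁻)^{m_N} φ₀`. -/
def phiM (N : ℕ) (m : Fin N → ℕ) : (Fin N → ℝ) → ℂ :=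
  fun x => ((1 / Real.sqrt ((∏ j, Nat.factorial (m j) : ℕ) : ℝ) : ℝ) : ℂ) *
    iterAminus m (gaussian N) x

/-- The polynomials `pₖ` with `(d/dx − 2πx)ᵏ exp(−πx²) = pₖ(x) exp(−πx²)`. -/
def hermitePoly : ℕ → Polynomial ℝ
  | 0 => 1
  | k + 1 => Polynomial.derivative (hermitePoly k) -
      Polynomial.C (4 * Real.pi) * Polynomial.X * hermitePoly k

/-- The (unnormalized) Hermite function `(d/dx − 2πx)ᵏ exp(−πx²)`. -/
def hermiteFun (k : ℕ) (t : ℝ) : ℝ :=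
  (hermitePoly k).eval t * Real.exp (-Real.pi * t ^ 2)

/-- The tensor product of the Hermite functions of degrees `m j`. -/
def hermiteProd {N : ℕ} (m : Fin N → ℕ) (x : Fin N → ℝ) : ℝ :=
  ∏ j, hermiteFun (m j) (x j)

lemma derivative_hermitePoly (k : ℕ) :
    Polynomial.derivative (hermitePoly k) =
      -Polynomial.C (4 * Real.pi * k) * hermitePoly (k - 1) := by
  induction k with
  | zero => simp [hermitePoly]
  | succ k ih =>
    rcases k with _ | k
    · simp [hermitePoly]
    · rw [hermitePoly, Polynomial.derivative_sub, Polynomial.derivative_mul]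
      conv_lhs => rw [ih]
      simp only [Nat.add_sub_cancel] at ih ⊢
      rw [Polynomial.derivative_mul, hermitePoly]
      simp only [Polynomial.derivative_neg, Polynomial.derivative_C, Polynomial.derivative_mul,
        Polynomial.derivative_X, Polynomial.derivative_add, Polynomial.derivative_one, Nat.cast_add, Nat.cast_one, Polynomial.C_mul, Polynomial.C_add,
        Polynomial.C_1]
      ring

lemma hermitePoly_natDegree (k : ℕ) :
    (hermitePoly k).natDegree = k ∧ hermitePoly k ≠ 0 := by
  have hC : Polynomial.C (4 * Real.pi) * Polynomial.X ≠ (0 : Polynomial ℝ) :=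
    mul_ne_zero (Polynomial.C_ne_zero.2 (by positivity)) Polynomial.X_ne_zero
  induction k with
  | zero => simp [hermitePoly]
  | succ k ih =>
    have hdeg : (Polynomial.C (4 * Real.pi) * Polynomial.X * hermitePoly k).natDegree = k + 1 := by
      rw [Polynomial.natDegree_mul hC ih.2, Polynomial.natDegree_C_mul_X _ (by positivity), ih.1,
        add_comm]
    have hlt : (Polynomial.derivative (hermitePoly k)).natDegree <
        (Polynomial.C (4 * Real.pi) * Polynomial.X * hermitePoly k).natDegree := by
      rw [hdeg]
      exact lt_of_le_of_lt (Polynomial.natDegree_derivative_le _) (by omega)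
    have h : (hermitePoly (k + 1)).natDegree = k + 1 := by
      rw [hermitePoly, Polynomial.natDegree_sub_eq_right_of_natDegree_lt hlt, hdeg]
    refine ⟨h, fun h0 => ?_⟩
    simp [h0] at h

lemma mul_hermiteFun (k : ℕ) (t : ℝ) :
    t * hermiteFun k t =
      -(1 / (4 * Real.pi)) * hermiteFun (k + 1) t - k * hermiteFun (k - 1) t := by
  have h := Real.pi_ne_zero
  simp only [hermiteFun, hermitePoly, derivative_hermitePoly]
  simp
  field_simp
  ring

lemma hasDerivAt_hermiteFun (k : ℕ) (t : ℝ) :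
    HasDerivAt (hermiteFun k) (hermiteFun (k + 1) t + 2 * Real.pi * t * hermiteFun k t) t := by
  have h1 := (hermitePoly k).hasDerivAt t
  have h2 : HasDerivAt (fun t : ℝ => Real.exp (-Real.pi * t ^ 2))
      (Real.exp (-Real.pi * t ^ 2) * (-Real.pi * (2 * t))) t := by
    simpa using ((hasDerivAt_pow 2 t).const_mul (-Real.pi)).exp
  refine (h1.mul h2).congr_deriv ?_
  simp [hermiteFun, hermitePoly]
  ring

lemma continuous_hermiteFun (k : ℕ) : Continuous (hermiteFun k) :=
  continuous_iff_continuousAt.2 fun t => (hasDerivAt_hermiteFun k t).continuousAt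

lemma integrable_eval_mul_exp {b : ℝ} (hb : 0 < b) (p : Polynomial ℝ) :
    Integrable (fun t : ℝ => p.eval t * Real.exp (-b * t ^ 2)) := by
  induction p using Polynomial.induction_on' with
  | add p q hp hq =>
    simp only [Polynomial.eval_add, add_mul]
    exact hp.add hq
  | monomial n a =>
    have h := (integrable_rpow_mul_exp_neg_mul_sq hb (s := n)
      (by linarith [n.cast_nonneg (α := ℝ)])).const_mul a
    simpa [mul_assoc] using h

lemma hermiteFun_mul_hermiteFun (k l : ℕ) (t : ℝ) :
    hermiteFun k t * hermiteFun l t =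
      (hermitePoly k * hermitePoly l).eval t * Real.exp (-(2 * Real.pi) * t ^ 2) := by
  rw [hermiteFun, hermiteFun, Polynomial.eval_mul, mul_mul_mul_comm, ← Real.exp_add]
  congr 2
  ring

lemma integrable_hermiteFun_mul (k l : ℕ) :
    Integrable (fun t => hermiteFun k t * hermiteFun l t) := by
  simp only [hermiteFun_mul_hermiteFun]
  exact integrable_eval_mul_exp (by positivity) _

lemma integral_eval_mul_hermitePoly (k : ℕ) (q : Polynomial ℝ) (hq : q.degree < k) :
    ∫ t, (q * hermitePoly k).eval t * Real.exp (-(2 * Real.pi) * t ^ 2) = 0 := by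
  have hb : 0 < 2 * Real.pi := by positivity
  induction k generalizing q with
  | zero =>
    have : q = 0 := by simpa [← Polynomial.degree_eq_bot, Nat.WithBot.lt_zero_iff] using hq
    simp [this]
  | succ k ih =>
    have hI := integrable_eval_mul_exp hb
    have hd (t : ℝ) : HasDerivAt
        (fun t => (q * hermitePoly k).eval t * Real.exp (-(2 * Real.pi) * t ^ 2))
        ((Polynomial.derivative q * hermitePoly k).eval t * Real.exp (-(2 * Real.pi) * t ^ 2) +
          (q * hermitePoly (k + 1)).eval t * Real.exp (-(2 * Real.pi) * t ^ 2)) t := by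
      have h2 : HasDerivAt (fun t : ℝ => Real.exp (-(2 * Real.pi) * t ^ 2))
          (Real.exp (-(2 * Real.pi) * t ^ 2) * (-(2 * Real.pi) * (2 * t))) t := by
        simpa using ((hasDerivAt_pow 2 t).const_mul (-(2 * Real.pi))).exp
      refine (((q * hermitePoly k).hasDerivAt t).mul h2).congr_deriv ?_
      simp [hermitePoly]
      ring
    have h0 := integral_eq_zero_of_hasDerivAt_of_integrable hd ((hI _).add (hI _)) (hI _)
    rw [integral_add (hI _) (hI _)] at h0
    have hder : (Polynomial.derivative q).degree < k := by
      rw [Polynomial.degree_lt_iff_coeff_zero] at hq ⊢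
      intro m hm
      rw [Polynomial.coeff_derivative, hq _ (by omega), zero_mul]
    rw [ih _ hder, zero_add] at h0
    exact h0

lemma integral_hermiteFun_mul {k l : ℕ} (h : k ≠ l) :
    ∫ t, hermiteFun k t * hermiteFun l t = 0 := by
  wlog hkl : k < l generalizing k l
  · simp_rw [mul_comm (hermiteFun k _)]
    exact this h.symm (by omega)
  simp only [hermiteFun_mul_hermiteFun]
  refine integral_eval_mul_hermitePoly l _ ?_
  rw [Polynomial.degree_eq_natDegree (hermitePoly_natDegree k).2, (hermitePoly_natDegree k).1]
  exact_mod_cast hkl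

lemma hermiteProd_update {N : ℕ} (m : Fin N → ℕ) (j : Fin N) (k : ℕ) (x : Fin N → ℝ) :
    hermiteProd (Function.update m j k) x =
      hermiteFun k (x j) * ∏ i ∈ Finset.univ.erase j, hermiteFun (m i) (x i) := by
  rw [hermiteProd, ← Finset.mul_prod_erase _ _ (Finset.mem_univ j), Function.update_self]
  congr 1
  refine Finset.prod_congr rfl fun i hi => ?_
  rw [Function.update_of_ne (Finset.ne_of_mem_erase hi)]

lemma hermiteProd_eq_mul {N : ℕ} (m : Fin N → ℕ) (j : Fin N) (x : Fin N → ℝ) :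
    hermiteProd m x =
      hermiteFun (m j) (x j) * ∏ i ∈ Finset.univ.erase j, hermiteFun (m i) (x i) := by
  simpa using hermiteProd_update m j (m j) x

lemma continuous_hermiteProd {N : ℕ} (m : Fin N → ℕ) : Continuous (hermiteProd m) :=
  continuous_finsetProd _ fun j _ => (continuous_hermiteFun _).comp (continuous_apply j)

lemma pd_hermiteProd {N : ℕ} (m : Fin N → ℕ) (j : Fin N) (x : Fin N → ℝ) :
    pd j (fun x => ((hermiteProd m x : ℝ) : ℂ)) x =
      (((hermiteFun (m j + 1) (x j) + 2 * Real.pi * x j * hermiteFun (m j) (x j)) *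
        ∏ i ∈ Finset.univ.erase j, hermiteFun (m i) (x i) : ℝ) : ℂ) := by
  have h0 (i : Fin N) := (hasDerivAt_hermiteFun (m i) (x i)).comp_hasFDerivAt x
    (hasFDerivAt_apply (𝕜 := ℝ) (F' := fun _ : Fin N => ℝ) i x)
  have h1 : HasFDerivAt (hermiteProd m) _ x :=
    HasFDerivAt.finsetProd (u := Finset.univ) fun i _ => h0 i
  have h2 : HasFDerivAt (fun x => ((hermiteProd m x : ℝ) : ℂ)) _ x :=
    (Complex.ofRealCLM.hasFDerivAt).comp x h1
  rw [pd, h2.fderiv]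
  simp only [ContinuousLinearMap.comp_apply, Complex.ofRealCLM_apply,
    sum_apply, smul_apply,
    ContinuousLinearMap.proj_apply, smul_eq_mul]
  rw [Finset.sum_eq_single j (fun i _ hi => by simp [hi]) (by simp)]
  simp only [Pi.single_eq_same, mul_one]
  congr 1
  exact mul_comm _ _

lemma Aminus_hermiteProd {N : ℕ} (m : Fin N → ℕ) (j : Fin N) :
    Aminus j (fun x => ((hermiteProd m x : ℝ) : ℂ)) =
      fun x => ((hermiteProd (m + Pi.single j 1) x : ℝ) : ℂ) := by
  have hm : m + Pi.single j 1 = Function.update m j (m j + 1) := by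
    ext i
    by_cases hi : i = j
    · subst hi; simp
    · simp [hi]
  ext x
  rw [Aminus, pd_hermiteProd, hm, hermiteProd_update, hermiteProd_eq_mul m j x]
  push_cast
  ring

lemma Aminus_iterate_hermiteProd {N : ℕ} (m : Fin N → ℕ) (j : Fin N) (n : ℕ) :
    (fun h => Aminus j h)^[n] (fun x => ((hermiteProd m x : ℝ) : ℂ)) =
      fun x => ((hermiteProd (m + Pi.single j n) x : ℝ) : ℂ) := by
  induction n with
  | zero => simp
  | succ n ih =>
    rw [Function.iterate_succ_apply', ih, Aminus_hermiteProd, add_assoc, ← Pi.single_add]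

lemma iterAminus_gaussian {N : ℕ} (m : Fin N → ℕ) :
    iterAminus m (gaussian N) = fun x => ((hermiteProd m x : ℝ) : ℂ) := by
  have h0 : gaussian N = fun x => ((hermiteProd (0 : Fin N → ℕ) x : ℝ) : ℂ) := by
    ext x
    simp [gaussian, hermiteProd, hermiteFun, hermitePoly, ← Complex.exp_sum, Finset.mul_sum]
  have hfold (l : List (Fin N)) (k : Fin N → ℕ) :
      l.foldl (fun g j => (fun h => Aminus j h)^[m j] g)
          (fun x => ((hermiteProd k x : ℝ) : ℂ)) =
        fun x => ((hermiteProd (k + (l.map fun j => Pi.single j (m j)).sum) x : ℝ) : ℂ) := by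
    induction l generalizing k with
    | nil => simp
    | cons j l ih => rw [List.foldl_cons, Aminus_iterate_hermiteProd, ih, List.map_cons,
        List.sum_cons, add_assoc]
  rw [iterAminus, h0, hfold, zero_add, ← Fin.sum_univ_def, Finset.univ_sum_single]

/-- The normalizing constant `(m₁!⋯m_N!)^{−1/2}`. -/
def phiMConst {N : ℕ} (m : Fin N → ℕ) : ℝ :=
  1 / Real.sqrt ((∏ j, Nat.factorial (m j) : ℕ) : ℝ)

lemma phiMConst_ne_zero {N : ℕ} (m : Fin N → ℕ) : phiMConst m ≠ 0 := by
  have h : 0 < ∏ j, Nat.factorial (m j) := Finset.prod_pos fun j _ => Nat.factorial_pos _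
  have h' : (0 : ℝ) < ((∏ j, Nat.factorial (m j) : ℕ) : ℝ) := by exact_mod_cast h
  exact (one_div_pos.2 (Real.sqrt_pos.2 h')).ne'

lemma phiM_eq {N : ℕ} (m : Fin N → ℕ) :
    phiM N m = fun x => ((phiMConst m * hermiteProd m x : ℝ) : ℂ) := by
  ext x
  rw [phiM, iterAminus_gaussian, phiMConst, Complex.ofReal_mul]

lemma memLp_prod_apply {N : ℕ} {g : Fin N → ℝ → ℝ} (hg : ∀ j, Continuous (g j))
    (hi : ∀ j, Integrable (fun t => g j t * g j t)) :
    MemLp (fun x : Fin N → ℝ => ∏ j, g j (x j)) 2 := by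
  have hc : Continuous fun x : Fin N → ℝ => ∏ j, g j (x j) := by fun_prop
  rw [memLp_two_iff_integrable_sq hc.aestronglyMeasurable]
  simp only [pow_two, ← Finset.prod_mul_distrib]
  exact Integrable.fintype_prod (f := fun j t => g j t * g j t) hi

lemma memLp_hermiteProd {N : ℕ} (m : Fin N → ℕ) : MemLp (hermiteProd m) 2 :=
  memLp_prod_apply (fun j => continuous_hermiteFun (m j))
    (fun j => integrable_hermiteFun_mul (m j) (m j))

lemma exists_hermiteProd_ne_zero {N : ℕ} (m : Fin N → ℕ) : ∃ x, hermiteProd m x ≠ 0 := by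
  have h (k : ℕ) : ∃ t, hermiteFun k t ≠ 0 := by
    by_contra! h
    refine (hermitePoly_natDegree k).2 (Polynomial.funext fun t => ?_)
    simpa [hermiteFun, Real.exp_ne_zero] using h t
  choose t ht using h
  exact ⟨fun j => t (m j), Finset.prod_ne_zero_iff.2 fun j _ => ht _⟩

lemma integral_hermiteProd_mul {N : ℕ} {m n : Fin N → ℕ} (h : m ≠ n) :
    ∫ x, hermiteProd m x * hermiteProd n x = 0 := by
  obtain ⟨j, hj⟩ := Function.ne_iff.1 h
  simp only [hermiteProd, ← Finset.prod_mul_distrib]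
  rw [integral_fintype_prod_volume_eq_prod
    (fun j t => hermiteFun (m j) t * hermiteFun (n j) t)]
  exact Finset.prod_eq_zero (Finset.mem_univ j) (integral_hermiteFun_mul hj)

lemma apply_mul_mem_span_hermiteProd {N : ℕ} (j : Fin N) {w : (Fin N → ℝ) → ℝ}
    (hw : w ∈ Submodule.span ℝ (Set.range (hermiteProd (N := N)))) :
    (fun x => x j * w x) ∈ Submodule.span ℝ (Set.range (hermiteProd (N := N))) := by
  induction hw using Submodule.span_induction with
  | mem w hw =>
    obtain ⟨m, rfl⟩ := hw
    have h : (fun x => x j * hermiteProd m x) =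
        (-(1 / (4 * Real.pi))) • hermiteProd (Function.update m j (m j + 1)) -
          (m j : ℝ) • hermiteProd (Function.update m j (m j - 1)) := by
      ext x
      simp only [Pi.sub_apply, Pi.smul_apply, smul_eq_mul, hermiteProd_update]
      rw [hermiteProd_eq_mul m j, ← mul_assoc, mul_hermiteFun]
      ring
    rw [h]
    exact Submodule.sub_mem _
      (Submodule.smul_mem _ _ (Submodule.subset_span ⟨_, rfl⟩))
      (Submodule.smul_mem _ _ (Submodule.subset_span ⟨_, rfl⟩))
  | zero => simp [← Pi.zero_def]
  | add v w _ _ hv hw =>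
    convert Submodule.add_mem _ hv hw using 1
    ext x
    simp [mul_add]
  | smul a w _ hw =>
    convert Submodule.smul_mem _ a hw using 1
    ext x
    simp [mul_left_comm]

lemma dual_apply_eq_sum {N : ℕ} (L : StrongDual ℝ (Fin N → ℝ)) (x : Fin N → ℝ) :
    L x = ∑ j, L (Pi.single j 1) * x j := by
  conv_lhs => rw [pi_eq_sum_univ' x, map_sum]
  refine Finset.sum_congr rfl fun j _ => ?_
  rw [map_smul, smul_eq_mul, mul_comm]

lemma dual_pow_mul_mem_span_hermiteProd {N : ℕ} (L : StrongDual ℝ (Fin N → ℝ)) (k : ℕ) :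
    (fun x => L x ^ k * hermiteProd 0 x) ∈
      Submodule.span ℝ (Set.range (hermiteProd (N := N))) := by
  induction k with
  | zero =>
    simp only [pow_zero, one_mul]
    exact Submodule.subset_span ⟨0, rfl⟩
  | succ k ih =>
    have h : (fun x => L x ^ (k + 1) * hermiteProd 0 x) =
        ∑ j, L (Pi.single j 1) • fun x => x j * (L x ^ k * hermiteProd 0 x) := by
      ext x
      rw [pow_succ']
      conv_lhs => rw [dual_apply_eq_sum L x]
      simp only [Finset.sum_apply, Pi.smul_apply, smul_eq_mul, Finset.sum_mul, mul_assoc]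
      rw [← dual_apply_eq_sum L x]
    rw [h]
    exact Submodule.sum_mem _ fun j _ =>
      Submodule.smul_mem _ _ (apply_mul_mem_span_hermiteProd j ih)

lemma memLp_exp_mul_hermiteProd_zero {N : ℕ} (L : StrongDual ℝ (Fin N → ℝ)) :
    MemLp (fun x => Real.exp (L x) * hermiteProd 0 x) 2 := by
  have h : (fun x => Real.exp (L x) * hermiteProd 0 x) =
      fun x => ∏ j, (Real.exp (L (Pi.single j 1) * x j) * hermiteFun 0 (x j)) := by
    ext x
    rw [Finset.prod_mul_distrib, ← Real.exp_sum, ← dual_apply_eq_sum]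
    rfl
  rw [h]
  refine memLp_prod_apply (g := fun j t => Real.exp (L (Pi.single j 1) * t) * hermiteFun 0 t)
    (fun j => by have := continuous_hermiteFun 0; fun_prop) fun j => ?_
  have hI := (integrable_cexp_quadratic (b := ((2 * Real.pi : ℝ) : ℂ))
    (by rw [Complex.ofReal_re]; positivity) ((2 * L (Pi.single j 1) : ℝ) : ℂ) 0).norm
  refine hI.congr (Filter.Eventually.of_forall fun t => ?_)
  simp only [hermiteFun, hermitePoly, Polynomial.eval_one, one_mul, ← Real.exp_add,
    Complex.norm_exp, ← Complex.ofReal_neg, ← Complex.ofReal_pow, ← Complex.ofReal_mul,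
    ← Complex.ofReal_add, add_zero, Complex.ofReal_re]
  congr 1
  ring

/-- An integrable real function whose Fourier transform vanishes is zero almost everywhere. -/
lemma ae_eq_zero_of_forall_integral_cexp_mul_eq_zero {E : Type*} [NormedAddCommGroup E]
    [NormedSpace ℝ E] [CompleteSpace E] [SecondCountableTopology E] [MeasurableSpace E]
    [BorelSpace E] {μ : Measure E} {v : E → ℝ} (hv : Integrable v μ)
    (h : ∀ L : StrongDual ℝ E, ∫ x, Complex.exp (L x * Complex.I) * v x ∂μ = 0) :
    v =ᵐ[μ] 0 := by
  have := isFiniteMeasure_withDensity_ofReal hv.2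
  have := isFiniteMeasure_withDensity_ofReal hv.neg.2
  have hm := hv.aemeasurable
  have hchar (w : E → ℝ) (hw : Integrable w μ) (L : StrongDual ℝ E) :
      charFunDual (μ.withDensity fun x => ENNReal.ofReal (w x)) L =
        ∫ x, Complex.exp (L x * Complex.I) * (max (w x) 0 : ℝ) ∂μ := by
    rw [charFunDual_apply, integral_withDensity_eq_integral_toReal_smul₀
      hw.aemeasurable.ennreal_ofReal (by simp)]
    refine integral_congr_ae (Filter.Eventually.of_forall fun x => ?_)
    simp only [ENNReal.toReal_ofReal', Complex.real_smul]
    exact mul_comm _ _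
  have hint (w : E → ℝ) (hw : Integrable w μ) (L : StrongDual ℝ E) :
      Integrable (fun x => Complex.exp (L x * Complex.I) * (max (w x) 0 : ℝ)) μ := by
    refine hw.pos_part.ofReal.bdd_mul (c := 1) (by fun_prop)
      (Filter.Eventually.of_forall fun x => ?_)
    rw [Complex.norm_exp_ofReal_mul_I]
  have heq : μ.withDensity (fun x => ENNReal.ofReal (v x)) =
      μ.withDensity (fun x => ENNReal.ofReal ((-v) x)) := by
    refine Measure.ext_of_charFunDual (funext fun L => ?_)
    rw [hchar v hv, hchar (-v) hv.neg, ← sub_eq_zero,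
      ← integral_sub (hint v hv L) (hint (-v) hv.neg L), ← h L]
    refine integral_congr_ae (Filter.Eventually.of_forall fun x => ?_)
    simp only [Pi.neg_apply]
    rw [← mul_sub, ← Complex.ofReal_sub]
    congr 2
    exact max_zero_sub_max_neg_zero_eq_self (v x)
  rw [withDensity_eq_iff hm.ennreal_ofReal hm.neg.ennreal_ofReal
    (hv.lintegral_lt_top).ne] at heq
  filter_upwards [heq] with x hx
  have hx' := congrArg ENNReal.toReal hx
  simp only [ENNReal.toReal_ofReal', Pi.neg_apply] at hx'
  have := max_zero_sub_max_neg_zero_eq_self (v x)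
  rw [hx', sub_self] at this
  exact this.symm

lemma ae_eq_zero_of_forall_integral_hermiteProd_mul {N : ℕ} {u : (Fin N → ℝ) → ℝ}
    (hu : MemLp u 2) (h : ∀ m, ∫ x, hermiteProd m x * u x = 0) : u =ᵐ[volume] 0 := by
  have hspan {w : (Fin N → ℝ) → ℝ}
      (hw : w ∈ Submodule.span ℝ (Set.range (hermiteProd (N := N)))) :
      Integrable (fun x => w x * u x) ∧ ∫ x, w x * u x = 0 := by
    induction hw using Submodule.span_induction with
    | mem w hw =>
      obtain ⟨m, rfl⟩ := hw
      exact ⟨(memLp_hermiteProd m).integrable_mul hu, h m⟩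
    | zero => simp
    | add v w _ _ hv hw =>
      simp only [Pi.add_apply, add_mul]
      exact ⟨hv.1.add hw.1, by rw [integral_add hv.1 hw.1, hv.2, hw.2, add_zero]⟩
    | smul a w _ hw =>
      simp only [Pi.smul_apply, smul_eq_mul, mul_assoc]
      exact ⟨hw.1.const_mul a, by rw [integral_const_mul, hw.2, mul_zero]⟩
  have hv : Integrable (fun x => hermiteProd 0 x * u x) :=
    (memLp_hermiteProd 0).integrable_mul hu
  have hfourier (L : StrongDual ℝ (Fin N → ℝ)) :
      ∫ x, Complex.exp (L x * Complex.I) * ((hermiteProd 0 x * u x : ℝ) : ℂ) = 0 := by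
    have hF (k : ℕ) : ∫ x, (L x * Complex.I) ^ k / (k.factorial : ℂ) *
        ((hermiteProd 0 x * u x : ℝ) : ℂ) = 0 := by
      have h1 (x : Fin N → ℝ) : (L x * Complex.I) ^ k / (k.factorial : ℂ) *
          ((hermiteProd 0 x * u x : ℝ) : ℂ) =
          (Complex.I ^ k / (k.factorial : ℂ)) *
            ((L x ^ k * hermiteProd 0 x * u x : ℝ) : ℂ) := by
        push_cast
        ring
      simp_rw [h1]
      rw [integral_const_mul, integral_complex_ofReal, (hspan (dual_pow_mul_mem_span_hermiteProd L k)).2,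
        Complex.ofReal_zero, mul_zero]
    have hbound (x : Fin N → ℝ) :
        HasSum (fun k : ℕ => |L x| ^ k / (k.factorial : ℝ) * |hermiteProd 0 x * u x|)
          (Real.exp |L x| * |hermiteProd 0 x * u x|) := by
      rw [Real.exp_eq_exp_ℝ]
      exact (NormedSpace.expSeries_div_hasSum_exp |L x|).mul_right _
    have hexp : Integrable fun x => Real.exp |L x| * |hermiteProd 0 x * u x| := by
      have h1 := ((memLp_exp_mul_hermiteProd_zero L).integrable_mul hu).norm
      have h2 := ((memLp_exp_mul_hermiteProd_zero (-L)).integrable_mul hu).norm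
      refine (h1.add h2).mono' ?_ (Filter.Eventually.of_forall fun x => ?_)
      · exact (Continuous.aestronglyMeasurable (by fun_prop)).mul hv.1.norm
      · simp only [Pi.add_apply, Pi.mul_apply, norm_mul, Real.norm_eq_abs, abs_abs, abs_mul,
          Real.abs_exp, neg_apply]
        rw [mul_assoc, mul_assoc, ← add_mul]
        gcongr
        rcases abs_cases (L x) with ⟨h, -⟩ | ⟨h, -⟩ <;> rw [h] <;>
          linarith [Real.exp_pos (L x), Real.exp_pos (-L x)]
    have hsum := hasSum_integral_of_dominated_convergence (μ := volume)
      (F := fun (k : ℕ) x => (L x * Complex.I) ^ k / (k.factorial : ℂ) *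
        ((hermiteProd 0 x * u x : ℝ) : ℂ))
      (f := fun x => Complex.exp (L x * Complex.I) * ((hermiteProd 0 x * u x : ℝ) : ℂ))
      (fun k x => |L x| ^ k / (k.factorial : ℝ) * |hermiteProd 0 x * u x|)
      (fun k => (Continuous.aestronglyMeasurable (by fun_prop)).mul hv.ofReal.1)
      (fun k => Filter.Eventually.of_forall fun x => by simp)
      (Filter.Eventually.of_forall fun x => (hbound x).summable)
      (by simpa only [(hbound _).tsum_eq] using hexp)
      (Filter.Eventually.of_forall fun x => by
        rw [Complex.exp_eq_exp_ℂ]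
        exact (NormedSpace.expSeries_div_hasSum_exp (L x * Complex.I : ℂ)).mul_right _)
    simp only [hF] at hsum
    exact hsum.unique hasSum_zero
  filter_upwards [ae_eq_zero_of_forall_integral_cexp_mul_eq_zero hv hfourier] with x hx
  refine (mul_eq_zero.1 hx).resolve_left (Finset.prod_ne_zero_iff.2 fun j _ => ?_)
  simp [hermiteFun, hermitePoly, Real.exp_ne_zero]

lemma memLp_phiM {N : ℕ} (m : Fin N → ℕ) : MemLp (phiM N m) 2 := by
  rw [phiM_eq]
  exact ((memLp_hermiteProd m).const_mul (phiMConst m)).ofReal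

/-- The family `{φ_m}_{m ∈ ℕᴺ}` is an orthogonal basis of `L²(ℝᴺ; ℂ)`: each `φ_m`
defines a nonzero element of `L²`, distinct `φ_m` are orthogonal, and the closure of
their linear span is all of `L²(ℝᴺ; ℂ)`. -/
theorem phiM_orthogonal_basis (N : ℕ) (hN : 1 ≤ N) :
    ∃ Φ : (Fin N → ℕ) → Lp ℂ 2 (volume : Measure (Fin N → ℝ)),
      (∀ m, (Φ m : (Fin N → ℝ) → ℂ) =ᵐ[volume] phiM N m) ∧
      (∀ m, Φ m ≠ 0) ∧
      (∀ m n, m ≠ n → ⟪Φ m, Φ n⟫_ℂ = 0) ∧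
      (Submodule.span ℂ (Set.range Φ)).topologicalClosure = ⊤ := by
  refine ⟨fun m => (memLp_phiM m).toLp _, fun m => (memLp_phiM m).coeFn_toLp, fun m h0 => ?_,
    fun m n hmn => ?_, ?_⟩
  · have h1 : phiM N m =ᵐ[volume] 0 :=
      (memLp_phiM m).coeFn_toLp.symm.trans ((Lp.eq_zero_iff_ae_eq_zero).1 h0)
    have hc : Continuous (phiM N m) := by
      have := continuous_hermiteProd m
      rw [phiM_eq]
      fun_prop
    rw [hc.ae_eq_iff_eq volume continuous_zero] at h1
    obtain ⟨x, hx⟩ := exists_hermiteProd_ne_zero m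
    have h2 := congrFun h1 x
    simp only [phiM_eq, Pi.zero_apply, Complex.ofReal_eq_zero] at h2
    exact mul_ne_zero (phiMConst_ne_zero m) hx h2
  · rw [L2.inner_def]
    have h : ∀ᵐ x, ⟪(memLp_phiM m).toLp _ x, (memLp_phiM n).toLp _ x⟫_ℂ =
        (((phiMConst m * phiMConst n) * (hermiteProd m x * hermiteProd n x) : ℝ) : ℂ) := by
      filter_upwards [(memLp_phiM m).coeFn_toLp, (memLp_phiM n).coeFn_toLp] with x h1 h2
      rw [h1, h2, phiM_eq, phiM_eq, RCLike.inner_apply, Complex.conj_ofReal]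
      push_cast
      ring
    rw [integral_congr_ae h, integral_complex_ofReal, integral_const_mul, integral_hermiteProd_mul hmn,
      mul_zero, Complex.ofReal_zero]
  · rw [Submodule.topologicalClosure_eq_top_iff, Submodule.eq_bot_iff]
    intro f hf
    have hf2 : MemLp f 2 := Lp.memLp f
    have horth (m : Fin N → ℕ) : ∫ x, ((hermiteProd m x : ℝ) : ℂ) * f x = 0 := by
      have h0 := (Submodule.mem_orthogonal _ _).1 hf _ (Submodule.subset_span ⟨m, rfl⟩)
      rw [L2.inner_def] at h0
      have h : ∀ᵐ x, ⟪(memLp_phiM m).toLp _ x, f x⟫_ℂ =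
          (phiMConst m : ℂ) * (((hermiteProd m x : ℝ) : ℂ) * f x) := by
        filter_upwards [(memLp_phiM m).coeFn_toLp] with x h1
        rw [h1, phiM_eq, RCLike.inner_apply, Complex.conj_ofReal]
        push_cast
        ring
      rw [integral_congr_ae h, integral_const_mul] at h0
      exact (mul_eq_zero.1 h0).resolve_left (Complex.ofReal_ne_zero.2 (phiMConst_ne_zero m))
    have hint (m : Fin N → ℕ) : Integrable fun x => ((hermiteProd m x : ℝ) : ℂ) * f x :=
      (memLp_hermiteProd m).ofReal.integrable_mul hf2
    have hre := ae_eq_zero_of_forall_integral_hermiteProd_mul hf2.re fun m => by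
      have h := integral_re (hint m)
      rw [horth m] at h
      simpa using h
    have him := ae_eq_zero_of_forall_integral_hermiteProd_mul hf2.im fun m => by
      have h := integral_im (hint m)
      rw [horth m] at h
      simpa using h
    rw [Lp.eq_zero_iff_ae_eq_zero]
    filter_upwards [hre, him] with x h1 h2
    exact Complex.ext h1 h2

end
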